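/- For every t ∈ [0, T), the map x ↦ u^A(t, x) is differentiable on ℝ^d and its gradient D_x u^A(t, x) satisfies ‖D_x u^A(t, x)‖ ≤ L for all x ∈ ℝ^d; i.e. D_x u^A is uniformly bounded on [0, T) × ℝ^d. -/

import Mathlib

open MeasureTheory ProbabilityTheory Matrix Filter

noncomputable section

/-- Euclidean inner product on row vectors in `ℝ^d`. -/
def euclInner {d : ℕ} (x y : Fin d → ℝ) : ℝ := ∑ i, x i * y i

/-- Euclidean norm on row vectors in `ℝ^d`. -/
def euclNorm {d : ℕ} (x : Fin d → ℝ) : ℝ := Real.sqrt (∑ i, (x i) ^ 2)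

/-- `g^A(x) := sup_y [ f(x+y) − ⟨yσ⁻¹, y⟩/(2√A) ]`. -/
def gA {d : ℕ} (A : ℝ) (σ : Matrix (Fin d) (Fin d) ℝ) (f : (Fin d → ℝ) → ℝ)
    (x : Fin d → ℝ) : ℝ :=
  sSup {r | ∃ y : Fin d → ℝ, r = f (x + y) - euclInner (y ᵥ* σ⁻¹) y / (2 * Real.sqrt A)}

/-- Centered Gaussian measure on `ℝ^d` with covariance `τ·I` (i.i.d. `N(0,τ)` coordinates). -/
def gaussPi (d : ℕ) (τ : ℝ) : Measure (Fin d → ℝ) :=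
  Measure.pi fun _ => gaussianReal 0 τ.toNNReal

/-- `u^A(t,x) := ∫ g^A(x + yσ) dμ_{T−t}(y)`. -/
def uA {d : ℕ} (T A : ℝ) (σ : Matrix (Fin d) (Fin d) ℝ) (f : (Fin d → ℝ) → ℝ)
    (t : ℝ) (x : Fin d → ℝ) : ℝ :=
  ∫ y, gA A σ f (x + y ᵥ* σ) ∂(gaussPi d (T - t))

theorem aux_pi_ac (ν : Measure ℝ) [SigmaFinite ν] (h : ν ≪ volume) (d : ℕ) :
    Measure.pi (fun _ : Fin d => ν) ≪ Measure.pi (fun _ : Fin d => (volume : Measure ℝ)) := by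
  induction d with
  | zero =>
    rw [Measure.pi_of_empty, Measure.pi_of_empty]
  | succ n ih =>
    have h1 := (measurePreserving_piFinSuccAbove (fun _ : Fin (n+1) => ν) 0).symm
    have h2 := (measurePreserving_piFinSuccAbove (fun _ : Fin (n+1) => (volume : Measure ℝ)) 0).symm
    rw [← h1.map_eq, ← h2.map_eq]
    exact (h.prod ih).map (MeasurableEquiv.measurable _)

theorem euclNorm_nonneg' {d : ℕ} (x : Fin d → ℝ) : 0 ≤ euclNorm x := Real.sqrt_nonneg _

theorem euclNorm_le {d : ℕ} (x : Fin d → ℝ) : euclNorm x ≤ d * ‖x‖ := by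
  unfold euclNorm
  apply Real.sqrt_le_iff.2
  refine ⟨by positivity, ?_⟩
  calc ∑ i, (x i)^2 ≤ ∑ _i : Fin d, ‖x‖^2 := by
        apply Finset.sum_le_sum
        intro i _
        rw [← sq_abs]
        have := norm_le_pi_norm x i
        rw [Real.norm_eq_abs] at this
        gcongr
    _ = d * ‖x‖^2 := by simp
    _ ≤ (d * ‖x‖)^2 := by
        rw [mul_pow]
        have : (d:ℝ) ≤ (d:ℝ)^2 := by
          have : d ≤ d^2 := Nat.le_self_pow (by norm_num) d
          exact_mod_cast this
        gcongr

theorem euclNorm_smul' {d : ℕ} (c : ℝ) (x : Fin d → ℝ) : euclNorm (c • x) = |c| * euclNorm x := by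
  unfold euclNorm
  rw [← Real.sqrt_sq_eq_abs, ← Real.sqrt_mul (sq_nonneg c), Finset.mul_sum]
  simp [mul_pow]

theorem gA_lip {d : ℕ} (σ : Matrix (Fin d) (Fin d) ℝ) (A : ℝ)
    (L : ℝ) (f : (Fin d → ℝ) → ℝ)
    (hf : ∀ x y, |f x - f y| ≤ L * euclNorm (x - y)) (x y : Fin d → ℝ) :
    |gA A σ f x - gA A σ f y| ≤ L * euclNorm (x - y) := by
  let S : (Fin d → ℝ) → Set ℝ := fun x =>
    {r | ∃ y : Fin d → ℝ, r = f (x + y) - euclInner (y ᵥ* σ⁻¹) y / (2 * Real.sqrt A)}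
  have hne : ∀ x, (S x).Nonempty := fun x => ⟨_, 0, rfl⟩
  have key : ∀ x x' z, f (x + z) ≤ f (x' + z) + L * euclNorm (x - x') := by
    intro x x' z
    have := (abs_le.1 (hf (x+z) (x'+z))).2
    rw [add_sub_add_right_eq_sub] at this
    linarith
  have hb : ∀ x x', BddAbove (S x') → BddAbove (S x) := by
    rintro x x' ⟨B, hB⟩
    refine ⟨B + L * euclNorm (x - x'), ?_⟩
    rintro r ⟨z, rfl⟩
    have := hB ⟨z, rfl⟩
    have := key x x' z
    linarith
  have hle : ∀ x x', BddAbove (S x') → sSup (S x) ≤ sSup (S x') + L * euclNorm (x - x') := by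
    intro x x' hB
    apply csSup_le (hne x)
    rintro r ⟨z, rfl⟩
    have := le_csSup hB ⟨z, rfl⟩
    have := key x x' z
    linarith
  have hsym : euclNorm (y - x) = euclNorm (x - y) := by
    have := euclNorm_smul' (-1) (x - y)
    simpa using this
  change |sSup (S x) - sSup (S y)| ≤ _
  by_cases hB : BddAbove (S y)
  · have h1 := hle x y hB
    have h2 := hle y x (hb x y hB)
    rw [hsym] at h2
    rw [abs_le]; constructor <;> linarith
  · have hB' : ¬ BddAbove (S x) := fun h => hB (hb y x h)
    rw [Real.sSup_of_not_bddAbove hB, Real.sSup_of_not_bddAbove hB']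
    simpa using (abs_nonneg _).trans (hf x y)

theorem integrable_id_gaussPi (d : ℕ) (τ : ℝ) :
    Integrable (fun y : Fin d → ℝ => ‖y‖) (gaussPi d τ) := by
  have h : ∀ i : Fin d, Integrable (fun y : Fin d → ℝ => ‖y i‖) (gaussPi d τ) := by
    intro i
    have h1 : Integrable (id : ℝ → ℝ) (gaussianReal 0 τ.toNNReal) :=
      memLp_one_iff_integrable.1 (memLp_id_gaussianReal 1)
    exact (integrable_comp_eval (μ := fun _ : Fin d => gaussianReal 0 τ.toNNReal) (i := i) h1).norm
  refine (integrable_finsetSum Finset.univ (fun i _ => h i)).mono'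
    (by fun_prop) (Eventually.of_forall fun y => ?_)
  rw [norm_norm]
  exact (pi_norm_le_iff_of_nonneg (by positivity)).2 fun i =>
    Finset.single_le_sum (f := fun i => ‖y i‖) (fun i _ => norm_nonneg _) (Finset.mem_univ i)

/-- For every `t ∈ [0,T)`, `x ↦ u^A(t,x)` is differentiable and its gradient has
Euclidean norm at most `L` (expressed as a bound of the differential w.r.t. the
Euclidean norm), uniformly on `[0,T) × ℝ^d`. -/
theorem stmt12 (T : ℝ) (hT : 0 < T) {d : ℕ} (hd : 1 ≤ d)
    (σ : Matrix (Fin d) (Fin d) ℝ) (hσ : σ.PosDef) (A : ℝ) (hA : 0 < A)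
    (L : ℝ) (f : (Fin d → ℝ) → ℝ)
    (hf : ∀ x y, |f x - f y| ≤ L * euclNorm (x - y)) :
    ∀ t : ℝ, 0 ≤ t → t < T →
      ∀ x : Fin d → ℝ,
        DifferentiableAt ℝ (uA T A σ f t) x ∧
        ∀ v : Fin d → ℝ, |fderiv ℝ (uA T A σ f t) x v| ≤ L * euclNorm v := by
  intro t _ htT x
  have hL : 0 ≤ L := by
    have h1 := (abs_nonneg _).trans (hf (fun _ => 1) 0)
    have h2 : 0 < euclNorm ((fun _ => 1 : Fin d → ℝ) - 0) := by
      simp only [euclNorm, sub_zero]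
      apply Real.sqrt_pos.2
      simp
      omega
    exact nonneg_of_mul_nonneg_left h1 h2
  set g := gA A σ f with hg
  have hgl : ∀ x y, |g x - g y| ≤ L * euclNorm (x - y) := gA_lip σ A L f hf
  have hlip : LipschitzWith (L * d).toNNReal g := by
    apply LipschitzWith.of_dist_le_mul
    intro a b
    rw [Real.dist_eq, dist_eq_norm, Real.coe_toNNReal _ (by positivity), mul_assoc]
    exact (hgl a b).trans (mul_le_mul_of_nonneg_left (euclNorm_le _) hL)
  set μ := gaussPi d (T - t) with hμ
  have : IsProbabilityMeasure μ := by rw [hμ]; unfold gaussPi; infer_instance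
  let M : (Fin d → ℝ) →L[ℝ] (Fin d → ℝ) := LinearMap.toContinuousLinearMap (Matrix.vecMulLinear σ)
  have hM : ∀ y, M y = y ᵥ* σ := fun y => rfl
  have hint : ∀ z, Integrable (fun y => g (z + y ᵥ* σ)) μ := by
    intro z
    have hc : Continuous (fun y => g (z + M y)) := hlip.continuous.comp (by fun_prop)
    have hI : Integrable (fun y : Fin d → ℝ => |g z| + (L * d) * (‖M‖ * ‖y‖)) μ :=
      (integrable_const _).add (((integrable_id_gaussPi d (T - t)).const_mul _).const_mul _)
    refine hI.mono' hc.aestronglyMeasurable (Eventually.of_forall fun y => ?_)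
    have h1 := hlip.dist_le_mul (z + M y) z
    rw [Real.dist_eq, dist_eq_norm, Real.coe_toNNReal _ (by positivity), add_sub_cancel_left] at h1
    have h2 : (L * d) * ‖M y‖ ≤ (L * d) * (‖M‖ * ‖y‖) :=
      mul_le_mul_of_nonneg_left (M.le_opNorm y) (by positivity)
    have h3 := abs_sub_abs_le_abs_sub (g (z + M y)) (g z)
    change |g (z + M y)| ≤ _
    linarith
  have hac : μ ≪ volume := by
    apply aux_pi_ac
    apply gaussianReal_absolutelyContinuous
    simpa using htT
  have hdet : LinearMap.det (Matrix.vecMulLinear σ) ≠ 0 := by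
    have h : Matrix.vecMulLinear σ = Matrix.toLin' σᵀ := by
      ext1 i; ext j; simp
    rw [h, LinearMap.det_toLin', Matrix.det_transpose]
    exact hσ.det_pos.ne'
  have hq : Measure.QuasiMeasurePreserving (fun y : Fin d → ℝ => x + y ᵥ* σ) volume volume :=
    ((measurePreserving_add_left volume x).quasiMeasurePreserving).comp
      (Measure.LinearMap.quasiMeasurePreserving volume _ hdet)
  have hdiff : ∀ᵐ y ∂μ, DifferentiableAt ℝ g (x + y ᵥ* σ) :=
    hac.ae_le (hq.ae (hlip.ae_differentiableAt (μ := volume)))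
  have main := (hasFDerivAt_integral_of_dominated_loc_of_lip (μ := μ) (𝕜 := ℝ)
    (F := fun z y => g (z + y ᵥ* σ)) (F' := fun y => fderiv ℝ g (x + y ᵥ* σ)) (x₀ := x)
    (bound := fun _ => L * d) (s := Set.univ) Filter.univ_mem
    (Eventually.of_forall fun z => (hint z).aestronglyMeasurable) (hint x)
    ((measurable_fderiv ℝ g).comp hq.measurable).aestronglyMeasurable
    (Eventually.of_forall fun y => by
      have h1 : LipschitzWith (L * d).toNNReal (fun z => g (z + y ᵥ* σ)) := by
        apply LipschitzWith.of_dist_le_mul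
        intro a b
        simpa only [dist_add_right] using hlip.dist_le_mul (a + y ᵥ* σ) (b + y ᵥ* σ)
      have h2 : Real.nnabs (L * d) = (L * d).toNNReal :=
        Real.nnabs_of_nonneg (by positivity)
      rw [h2]
      exact h1.lipschitzOnWith)
    (integrable_const _)
    (hdiff.mono fun y hy => (hasFDerivAt_comp_add_right (f := g) (y ᵥ* σ)).2 hy.hasFDerivAt)).2
  have main' : HasFDerivAt (uA T A σ f t) (∫ y, fderiv ℝ g (x + y ᵥ* σ) ∂μ) x := main
  have hul : ∀ z w, |uA T A σ f t z - uA T A σ f t w| ≤ L * euclNorm (z - w) := by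
    intro z w
    change |(∫ y, g (z + y ᵥ* σ) ∂μ) - ∫ y, g (w + y ᵥ* σ) ∂μ| ≤ _
    rw [← integral_sub (hint z) (hint w)]
    have := norm_integral_le_of_norm_le_const (μ := μ) (C := L * euclNorm (z - w))
      (f := fun y => g (z + y ᵥ* σ) - g (w + y ᵥ* σ)) (Eventually.of_forall fun y => by
        have := hgl (z + y ᵥ* σ) (w + y ᵥ* σ)
        rwa [add_sub_add_right_eq_sub] at this)
    simpa using this
  refine ⟨main'.differentiableAt, fun v => ?_⟩
  have hline := (main'.differentiableAt.hasFDerivAt).hasLineDerivAt v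
  have hl : HasDerivAt (fun s : ℝ => uA T A σ f t (x + s • v)) (fderiv ℝ (uA T A σ f t) x v) 0 :=
    hline
  refine hl.le_of_lip' (mul_nonneg hL (euclNorm_nonneg' v)) (Eventually.of_forall fun s => ?_)
  have := hul (x + s • v) (x + (0:ℝ) • v)
  rw [add_sub_add_left_eq_sub, ← sub_smul, euclNorm_smul'] at this
  calc _ ≤ _ := this
    _ = _ := by rw [Real.norm_eq_abs]; ring
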